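/- arXiv:2603.22427 — 6 statements merged into one kernel-verified Lean document; each statement's English description precedes it below -/
import Mathlib

section
/- For every stochastic encoder q, where q(m | x₀, x₁) ≥ 0 and Σ_{m∈{0,1}} q(m | x₀, x₁) = 1 for all x₀, x₁ ∈ {0,1}, and every stochastic decoder d, where d(y | s, m) ≥ 0 and Σ_{y∈{0,1}} d(y | s, m) = 1 for all s, m ∈ {0,1}, the prediction witness p_cor = (1/8)·Σ_{s,x₀,x₁ ∈ {0,1}} Σ_{m ∈ {0,1}} q(m | x₀, x₁)·d(x_s | s, m) is at most 3/4. Hence the classical value of the single-variable prediction witness satisfies β_C ≤ 3/4. -/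
/-- For every stochastic encoder `q(m | x₀,x₁)` and stochastic decoder
`d(y | s,m)` (nonnegative and normalized), the prediction witness
`(1/8) · Σ_{s,x₀,x₁} Σ_m q(m|x₀,x₁) · d(x_s|s,m)` is at most `3/4`. -/
theorem classical_rac_stochastic_bound
    (q : Bool → Bool → Bool → ℝ)  -- q x₀ x₁ m  =  q(m | x₀, x₁)
    (d : Bool → Bool → Bool → ℝ)  -- d s m y    =  d(y | s, m)
    (hq_nonneg : ∀ x₀ x₁ m, 0 ≤ q x₀ x₁ m)
    (hq_sum : ∀ x₀ x₁, ∑ m : Bool, q x₀ x₁ m = 1)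
    (hd_nonneg : ∀ s m y, 0 ≤ d s m y)
    (hd_sum : ∀ s m, ∑ y : Bool, d s m y = 1) :
    (1 / 8 : ℝ) *
      ∑ s : Bool, ∑ x₀ : Bool, ∑ x₁ : Bool, ∑ m : Bool,
        q x₀ x₁ m * d s m (if s then x₁ else x₀)
      ≤ 3 / 4 := by
  have key : ∀ u S : ℝ, -1 ≤ u → u ≤ 1 → u * S ≤ |S| := by
    intro u S h1 h2
    calc u * S ≤ |u * S| := le_abs_self _
      _ = |u| * |S| := abs_mul _ _
      _ ≤ 1 * |S| := by
        gcongr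
        exact abs_le.mpr ⟨h1, h2⟩
      _ = |S| := one_mul _
  simp only [Fintype.sum_bool] at *
  have e : ∀ x y, q x y false = 1 - q x y true := fun x y => by linarith [hq_sum x y]
  have f : ∀ s m, d s m false = 1 - d s m true := fun s m => by linarith [hd_sum s m]
  have t0 : ∀ x y, 0 ≤ q x y true := fun x y => hq_nonneg x y true
  have t1 : ∀ x y, q x y true ≤ 1 := fun x y => by linarith [hq_nonneg x y false, e x y]
  have a0 : ∀ s m, 0 ≤ d s m true := fun x y => hd_nonneg x y true
  have a1 : ∀ s m, d s m true ≤ 1 := fun x y => by linarith [hd_nonneg x y false, f x y]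
  simp only [e, f, if_true, Bool.false_eq_true, if_false]
  have k1 := key (q true true true - q false false true)
    ((d false true true - d false false true) + (d true true true - d true false true))
    (by linarith [t0 true true, t1 false false]) (by linarith [t1 true true, t0 false false])
  have k2 := key (q true false true - q false true true)
    ((d false true true - d false false true) - (d true true true - d true false true))
    (by linarith [t0 true false, t1 false true]) (by linarith [t1 true false, t0 false true])
  have k3 : |(d false true true - d false false true) + (d true true true - d true false true)|
      + |(d false true true - d false false true) - (d true true true - d true false true)|
      ≤ 2 := by
    have := a0 true true
    have := a0 true false
    have := a0 false true
    have := a0 false false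
    have := a1 true true
    have := a1 true false
    have := a1 false true
    have := a1 false false
    rcases abs_cases ((d false true true - d false false true)
      + (d true true true - d true false true)) with h | h <;>
    rcases abs_cases ((d false true true - d false false true)
      - (d true true true - d true false true)) with h' | h' <;>
    linarith
  linarith
end

section
/- For every pair (x₀, x₁) ∈ {0,1}², the Born-rule probability of the correct outcome is the same for both queries and equals (1/2)(1 + 1/√2): namely |⟨e_{x₀}, ψ_{x₀,x₁}⟩|² = (1/2)(1 + 1/√2) and |⟨h_{x₁}, ψ_{x₀,x₁}⟩|² = (1/2)(1 + 1/√2), where e₀, e₁ is the computational basis and h₀, h₁ is the Hadamard basis of ℂ². -/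
open Real

/-- The qubit states `ψ_{x₀,x₁} = σ_x^{x₀} σ_z^{x₁} (cos(π/8)|0⟩ + sin(π/8)|1⟩)`. -/
noncomputable def qracState : Bool → Bool → Fin 2 → ℂ
  | false, false => ![Real.cos (π / 8), Real.sin (π / 8)]
  | true,  false => ![Real.sin (π / 8), Real.cos (π / 8)]
  | false, true  => ![Real.cos (π / 8), -Real.sin (π / 8)]
  | true,  true  => ![-Real.sin (π / 8), Real.cos (π / 8)]

/-- The computational basis `e₀ = (1,0)`, `e₁ = (0,1)` of `ℂ²`. -/
noncomputable def compBasis : Bool → Fin 2 → ℂ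
  | false => ![1, 0]
  | true  => ![0, 1]

/-- The Hadamard basis `h₀ = (1/√2)(1,1)`, `h₁ = (1/√2)(1,−1)` of `ℂ²`. -/
noncomputable def hadBasis : Bool → Fin 2 → ℂ
  | false => ![1 / Real.sqrt 2, 1 / Real.sqrt 2]
  | true  => ![1 / Real.sqrt 2, -(1 / Real.sqrt 2)]

/-- Born-rule probability `|⟨v, w⟩|²` for vectors of `ℂ²`. -/
noncomputable def born (v w : Fin 2 → ℂ) : ℝ :=
  Complex.normSq ((starRingEnd ℂ) (v 0) * w 0 + (starRingEnd ℂ) (v 1) * w 1)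

theorem born_ofReal (a b c d : ℝ) (v w : Fin 2 → ℂ) (h0 : v 0 = (a : ℂ)) (h1 : v 1 = (b : ℂ))
    (k0 : w 0 = (c : ℂ)) (k1 : w 1 = (d : ℂ)) : born v w = (a * c + b * d) ^ 2 := by
  unfold born
  rw [h0, h1, k0, k1, Complex.conj_ofReal, Complex.conj_ofReal, ← Complex.ofReal_mul,
    ← Complex.ofReal_mul, ← Complex.ofReal_add, Complex.normSq_ofReal, sq]

/-- For every `(x₀,x₁) ∈ {0,1}²`, the Born-rule probability of the
correct outcome is the same for both queries and equals `(1/2)(1 + 1/√2)`: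
`|⟨e_{x₀}, ψ_{x₀,x₁}⟩|² = (1/2)(1 + 1/√2)` and `|⟨h_{x₁}, ψ_{x₀,x₁}⟩|² = (1/2)(1 + 1/√2)`. -/
theorem qrac_state_born_probabilities (x₀ x₁ : Bool) :
    born (compBasis x₀) (qracState x₀ x₁) = (1 / 2) * (1 + 1 / Real.sqrt 2) ∧
    born (hadBasis x₁) (qracState x₀ x₁) = (1 / 2) * (1 + 1 / Real.sqrt 2) := by
  have hu : (1 / Real.sqrt 2) ^ 2 = 1 / 2 := by
    rw [div_pow, Real.sq_sqrt (by norm_num)]; norm_num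
  have hv : Real.sqrt 2 / 2 = 1 / Real.sqrt 2 := by
    rw [div_eq_div_iff (by norm_num) (by positivity), Real.mul_self_sqrt (by norm_num)]; norm_num
  have h1 := Real.sin_sq_add_cos_sq (π / 8)
  have h2 : 2 * Real.cos (π / 8) ^ 2 - 1 = 1 / Real.sqrt 2 := by
    rw [← Real.cos_two_mul, ← hv, ← Real.cos_pi_div_four]; congr 1; ring
  have h3 : 2 * Real.sin (π / 8) * Real.cos (π / 8) = 1 / Real.sqrt 2 := by
    rw [← Real.sin_two_mul, ← hv, ← Real.sin_pi_div_four]; congr 1; ring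
  have key : (1 / Real.sqrt 2) ^ 2 * (Real.cos (π / 8) + Real.sin (π / 8)) ^ 2
      = (1 / 2) * (1 + 1 / Real.sqrt 2) := by
    rw [hu]; linear_combination (1 / 2) * h1 + (1 / 2) * h3
  have key0 : Real.cos (π / 8) ^ 2 = (1 / 2) * (1 + 1 / Real.sqrt 2) := by
    linear_combination (1 / 2) * h2
  cases x₀ <;> cases x₁ <;> constructor
  · rw [born_ofReal (1) (0) (Real.cos (π / 8)) (Real.sin (π / 8)) _ _ (by simp [compBasis, hadBasis])
      (by simp [compBasis, hadBasis]) (by simp [qracState]) (by simp [qracState]), ← key0]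
    ring
  · rw [born_ofReal (1 / Real.sqrt 2) (1 / Real.sqrt 2) (Real.cos (π / 8)) (Real.sin (π / 8)) _ _ (by simp [compBasis, hadBasis])
      (by simp [compBasis, hadBasis]) (by simp [qracState]) (by simp [qracState]), ← key]
    ring
  · rw [born_ofReal (1) (0) (Real.cos (π / 8)) (-Real.sin (π / 8)) _ _ (by simp [compBasis, hadBasis])
      (by simp [compBasis, hadBasis]) (by simp [qracState]) (by simp [qracState]), ← key0]
    ring
  · rw [born_ofReal (1 / Real.sqrt 2) (-(1 / Real.sqrt 2)) (Real.cos (π / 8)) (-Real.sin (π / 8)) _ _ (by simp [compBasis, hadBasis])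
      (by simp [compBasis, hadBasis]) (by simp [qracState]) (by simp [qracState]), ← key]
    ring
  · rw [born_ofReal (0) (1) (Real.sin (π / 8)) (Real.cos (π / 8)) _ _ (by simp [compBasis, hadBasis])
      (by simp [compBasis, hadBasis]) (by simp [qracState]) (by simp [qracState]), ← key0]
    ring
  · rw [born_ofReal (1 / Real.sqrt 2) (1 / Real.sqrt 2) (Real.sin (π / 8)) (Real.cos (π / 8)) _ _ (by simp [compBasis, hadBasis])
      (by simp [compBasis, hadBasis]) (by simp [qracState]) (by simp [qracState]), ← key]
    ring
  · rw [born_ofReal (0) (1) (-Real.sin (π / 8)) (Real.cos (π / 8)) _ _ (by simp [compBasis, hadBasis])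
      (by simp [compBasis, hadBasis]) (by simp [qracState]) (by simp [qracState]), ← key0]
    ring
  · rw [born_ofReal (1 / Real.sqrt 2) (-(1 / Real.sqrt 2)) (-Real.sin (π / 8)) (Real.cos (π / 8)) _ _ (by simp [compBasis, hadBasis])
      (by simp [compBasis, hadBasis]) (by simp [qracState]) (by simp [qracState]), ← key]
    ring
end

section
/- For every family of 2×2 complex density matrices ρ_{x₀,x₁} (positive semidefinite with trace 1) indexed by (x₀, x₁) ∈ {0,1}², and every pair of qubit POVMs {M^s_0, M^s_1} for s ∈ {0,1} (each M^s_y a 2×2 positive semidefinite matrix with M^s_0 + M^s_1 = I), the quantum prediction witness satisfies (1/8)·Σ_{s,x₀,x₁ ∈ {0,1}} Re Tr(M^s_{x_s} ρ_{x₀,x₁}) ≤ (1/2)(1 + 1/√2). Hence the quantum value of the single-variable witness satisfies β_Q ≤ (1/2)(1 + 1/√2). -/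
open scoped ComplexOrder

theorem qrac_param (P : Matrix (Fin 2) (Fin 2) ℂ) (h : P.PosSemidef) :
    ∃ p q u v : ℝ, P = !![(p : ℂ), ⟨u, v⟩; ⟨u, -v⟩, (q : ℂ)] ∧ 0 ≤ p ∧ 0 ≤ q ∧
      u ^ 2 + v ^ 2 ≤ p * q := by
  have h0 := h.diag_nonneg (i := 0)
  have h1 := h.diag_nonneg (i := 1)
  have hd := h.det_nonneg
  have h01 := h.1.apply 1 0
  rw [Complex.nonneg_iff] at h0 h1 hd
  have e01 : P 1 0 = ⟨(P 0 1).re, -(P 0 1).im⟩ := by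
    rw [← h01]; apply Complex.ext <;> simp
  refine ⟨(P 0 0).re, (P 1 1).re, (P 0 1).re, (P 0 1).im, ?_, h0.1, h1.1, ?_⟩
  · ext i j
    fin_cases i <;> fin_cases j <;> apply Complex.ext <;> simp [e01, ← h0.2, ← h1.2]
  · have := hd.1
    rw [Matrix.det_fin_two, e01] at this
    simp [← h0.2, ← h1.2] at this
    nlinarith

theorem qrac_state (P : Matrix (Fin 2) (Fin 2) ℂ) (h : P.PosSemidef) (ht : P.trace = 1) :
    ∃ x y z : ℝ, x ^ 2 + y ^ 2 + z ^ 2 ≤ 1 ∧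
      P = !![(((1 + z) / 2 : ℝ) : ℂ), ⟨x / 2, y / 2⟩; ⟨x / 2, -(y / 2)⟩, (((1 - z) / 2 : ℝ) : ℂ)] := by
  obtain ⟨p, q, u, v, rfl, hp, hq, hh⟩ := qrac_param P h
  have hs : p + q = 1 := by
    have := congrArg Complex.re ht
    simpa [Matrix.trace_fin_two] using this
  obtain rfl : q = 1 - p := by linarith
  refine ⟨2 * u, 2 * v, 2 * p - 1, by nlinarith, ?_⟩
  congr! 4 <;> first | ring | skip
  all_goals (congr! 2 <;> ring)

theorem qrac_meas (P Q : Matrix (Fin 2) (Fin 2) ℂ) (h : P.PosSemidef) (hQ : Q.PosSemidef)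
    (hs : P + Q = 1) :
    ∃ t a b c : ℝ, a ^ 2 + b ^ 2 + c ^ 2 ≤ 1 ∧ ∀ (x y z : ℝ) (R : Matrix (Fin 2) (Fin 2) ℂ),
      R = !![(((1 + z) / 2 : ℝ) : ℂ), ⟨x / 2, y / 2⟩; ⟨x / 2, -(y / 2)⟩, (((1 - z) / 2 : ℝ) : ℂ)] →
      (P * R).trace.re = (1 + t + (a * x + b * y + c * z)) / 2 ∧
      (Q * R).trace.re = (1 - t - (a * x + b * y + c * z)) / 2 := by
  obtain ⟨p, q, u, v, rfl, hp, hq, hh⟩ := qrac_param P h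
  obtain ⟨p', q', u', v', rfl, hp', hq', hh'⟩ := qrac_param Q hQ
  have e0 := congrArg Complex.re (congrFun (congrFun hs 0) 0)
  have e1 := congrArg Complex.re (congrFun (congrFun hs 1) 1)
  have e2 := congrArg Complex.re (congrFun (congrFun hs 0) 1)
  have e3 := congrArg Complex.im (congrFun (congrFun hs 0) 1)
  simp at e0 e1 e2 e3
  obtain rfl : p' = 1 - p := by linarith
  obtain rfl : q' = 1 - q := by linarith
  obtain rfl : u' = - u := by linarith
  obtain rfl : v' = - v := by linarith
  refine ⟨p + q - 1, 2 * u, 2 * v, p - q, ?_, ?_⟩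
  · rcases le_total (p + q) 1 with h1 | h1 <;> nlinarith
  · rintro x y z R rfl
    constructor <;>
    · rw [Matrix.trace_fin_two]
      simp [Matrix.mul_apply, Fin.sum_univ_two, -Complex.ofReal_div, -Complex.ofReal_add, -Complex.ofReal_sub]
      ring

theorem qrac_amgm (k d₁ d₂ d₃ x y z : ℝ) (hk : 0 < k) (hk2 : k ^ 2 = 2)
    (h : x ^ 2 + y ^ 2 + z ^ 2 ≤ 1) :
    d₁ * x + d₂ * y + d₃ * z ≤ k / 4 * (d₁ ^ 2 + d₂ ^ 2 + d₃ ^ 2) + k / 2 := by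
  have e : ∀ d w : ℝ, d * w ≤ k / 4 * d ^ 2 + k / 2 * w ^ 2 := by
    intro d w
    have : k / 4 * d ^ 2 + k / 2 * w ^ 2 - d * w = k / 4 * (d - k * w) ^ 2 := by
      linear_combination (d * w / 2 - k * w ^ 2 / 4) * hk2
    have : 0 ≤ k / 4 * (d - k * w) ^ 2 := by positivity
    linarith
  nlinarith [e d₁ x, e d₂ y, e d₃ z]

/-- For every family of qubit density matrices `ρ_{x₀,x₁}` and every pair
of qubit POVMs `{M^s_0, M^s_1}` (`s ∈ {0,1}`), the quantum prediction witness satisfies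
`(1/8) · Σ_{s,x₀,x₁} Re Tr(M^s_{x_s} ρ_{x₀,x₁}) ≤ (1/2)(1 + 1/√2)`. -/
theorem qrac_quantum_bound
    (ρ : Bool → Bool → Matrix (Fin 2) (Fin 2) ℂ)
    (hρ_pos : ∀ x₀ x₁, (ρ x₀ x₁).PosSemidef)
    (hρ_tr : ∀ x₀ x₁, (ρ x₀ x₁).trace = 1)
    (M : Bool → Bool → Matrix (Fin 2) (Fin 2) ℂ)  -- M s y = Mˢ_y
    (hM_pos : ∀ s y, (M s y).PosSemidef)
    (hM_sum : ∀ s, M s false + M s true = 1) :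
    (1 / 8 : ℝ) *
      ∑ s : Bool, ∑ x₀ : Bool, ∑ x₁ : Bool,
        ((M s (if s then x₁ else x₀) * ρ x₀ x₁).trace).re
      ≤ (1 / 2) * (1 + 1 / Real.sqrt 2) := by
  obtain ⟨t, a, b, c, hA, fA⟩ := qrac_meas _ _ (hM_pos false false) (hM_pos false true) (hM_sum false)
  obtain ⟨t', a', b', c', hB, fB⟩ := qrac_meas _ _ (hM_pos true false) (hM_pos true true) (hM_sum true)
  choose x y z hr hR using fun i j => qrac_state _ (hρ_pos i j) (hρ_tr i j)
  have gA := fun i j => fA _ _ _ _ (hR i j)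
  have gB := fun i j => fB _ _ _ _ (hR i j)
  have hk : 0 < Real.sqrt 2 := by positivity
  have hk2 : Real.sqrt 2 ^ 2 = 2 := Real.sq_sqrt (by norm_num)
  have hi : 1 / Real.sqrt 2 = Real.sqrt 2 / 2 := by
    field_simp; linarith
  rw [hi]
  simp only [Fintype.sum_bool, if_true, Bool.false_eq_true, if_false, (gA _ _).1, (gA _ _).2,
    (gB _ _).1, (gB _ _).2]
  generalize Real.sqrt 2 = k at *
  have n1 := qrac_amgm k (a + a') (b + b') (c + c') _ _ _ hk hk2 (hr false false)
  have n2 := qrac_amgm k (a - a') (b - b') (c - c') _ _ _ hk hk2 (hr false true)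
  have n3 := qrac_amgm k (-a + a') (-b + b') (-c + c') _ _ _ hk hk2 (hr true false)
  have n4 := qrac_amgm k (-a - a') (-b - b') (-c - c') _ _ _ hk hk2 (hr true true)
  have m1 := mul_le_mul_of_nonneg_left hA hk.le
  have m2 := mul_le_mul_of_nonneg_left hB hk.le
  linarith
end

section
/- The quantum informationally-restricted perceptron strictly outperforms every classical one for the single-variable function: for every encoding E : {0,1}² → {0,1} and decoding D : {0,1} × {0,1} → {0,1}, the classical witness value (1/8)·#{(s, x₀, x₁) ∈ {0,1}³ : D(s, E(x₀, x₁)) = x_s} is at most 3/4, which is strictly less than the value (1/8)·Σ_{x₀,x₁ ∈ {0,1}} ( |⟨e_{x₀}, ψ_{x₀,x₁}⟩|² + |⟨h_{x₁}, ψ_{x₀,x₁}⟩|² ) = (1/2)(1 + 1/√2) achieved by the explicit quantum strategy. -/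
open Real

/-- The quantum informationally-restricted perceptron strictly outperforms
every classical one for the single-variable function: every deterministic classical
strategy achieves at most `3/4`, which is strictly less than the value
`(1/2)(1 + 1/√2)` achieved by the explicit quantum strategy. -/
theorem qrac_quantum_beats_classical :
    (∀ (E : Bool → Bool → Bool) (D : Bool → Bool → Bool),
      (1 / 8 : ℝ) *
        ((Finset.univ : Finset (Bool × Bool × Bool)).filter
          (fun t => D t.1 (E t.2.1 t.2.2) = (if t.1 then t.2.2 else t.2.1))).card
        ≤ 3 / 4) ∧
    (1 / 8 : ℝ) *
      ∑ x₀ : Bool, ∑ x₁ : Bool,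
        (born (compBasis x₀) (qracState x₀ x₁) + born (hadBasis x₁) (qracState x₀ x₁))
      = (1 / 2) * (1 + 1 / Real.sqrt 2) ∧
    (3 / 4 : ℝ) < (1 / 2) * (1 + 1 / Real.sqrt 2) := by
  have h2 : Real.sqrt 2 * Real.sqrt 2 = 2 := Real.mul_self_sqrt (by norm_num)
  have hpos : 0 < Real.sqrt 2 := Real.sqrt_pos.mpr (by norm_num)
  have hinv : 1 / Real.sqrt 2 = Real.sqrt 2 / 2 := by
    field_simp
    nlinarith
  refine ⟨?_, ?_, ?_⟩
  · intro E D
    have key : ((Finset.univ : Finset (Bool × Bool × Bool)).filter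
          (fun t => D t.1 (E t.2.1 t.2.2) = (if t.1 then t.2.2 else t.2.1))).card ≤ 6 := by
      rw [Finset.card_filter]
      simp only [Fintype.sum_prod_type, Fintype.sum_bool]
      cases E true true <;> cases E true false <;> cases E false true <;>
        cases E false false <;> cases D true true <;> cases D true false <;>
        cases D false true <;> cases D false false <;> decide
    have key' : (((Finset.univ : Finset (Bool × Bool × Bool)).filter
          (fun t => D t.1 (E t.2.1 t.2.2) = (if t.1 then t.2.2 else t.2.1))).card : ℝ) ≤ 6 := by
      exact_mod_cast key
    linarith
  · have hcs := Real.sin_sq_add_cos_sq (π / 8)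
    have hc : Real.cos (π / 8) ^ 2 = 1 / 2 + Real.sqrt 2 / 4 := by
      rw [Real.cos_sq, show 2 * (π / 8) = π / 4 by ring, Real.cos_pi_div_four]
      ring
    have hs : 2 * Real.sin (π / 8) * Real.cos (π / 8) = Real.sqrt 2 / 2 := by
      rw [← Real.sin_two_mul, show 2 * (π / 8) = π / 4 by ring, Real.sin_pi_div_four]
    have hb : ∀ a b c d : ℝ, ∀ v w : Fin 2 → ℂ, v 0 = (a : ℂ) → v 1 = (b : ℂ) →
        w 0 = (c : ℂ) → w 1 = (d : ℂ) → born v w = (a * c + b * d) ^ 2 := by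
      intro a b c d v w h0 h1 h3 h4
      unfold born
      rw [h0, h1, h3, h4, Complex.conj_ofReal, Complex.conj_ofReal, ← Complex.ofReal_mul,
        ← Complex.ofReal_mul, ← Complex.ofReal_add, Complex.normSq_ofReal]
      ring
    simp only [Fintype.sum_bool]
    rw [hb 0 1 (-Real.sin (π / 8)) (Real.cos (π / 8)) (compBasis true) (qracState true true)
        (by simp [compBasis]) (by simp [compBasis]) (by simp [qracState]) (by simp [qracState]),
      hb 0 1 (Real.sin (π / 8)) (Real.cos (π / 8)) (compBasis true) (qracState true false)
        (by simp [compBasis]) (by simp [compBasis]) (by simp [qracState]) (by simp [qracState]),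
      hb 1 0 (Real.cos (π / 8)) (-Real.sin (π / 8)) (compBasis false) (qracState false true)
        (by simp [compBasis]) (by simp [compBasis]) (by simp [qracState]) (by simp [qracState]),
      hb 1 0 (Real.cos (π / 8)) (Real.sin (π / 8)) (compBasis false) (qracState false false)
        (by simp [compBasis]) (by simp [compBasis]) (by simp [qracState]) (by simp [qracState]),
      hb (1 / Real.sqrt 2) (-(1 / Real.sqrt 2)) (-Real.sin (π / 8)) (Real.cos (π / 8))
        (hadBasis true) (qracState true true)
        (by simp [hadBasis]) (by simp [hadBasis]) (by simp [qracState]) (by simp [qracState]),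
      hb (1 / Real.sqrt 2) (1 / Real.sqrt 2) (Real.sin (π / 8)) (Real.cos (π / 8))
        (hadBasis false) (qracState true false)
        (by simp [hadBasis]) (by simp [hadBasis]) (by simp [qracState]) (by simp [qracState]),
      hb (1 / Real.sqrt 2) (-(1 / Real.sqrt 2)) (Real.cos (π / 8)) (-Real.sin (π / 8))
        (hadBasis true) (qracState false true)
        (by simp [hadBasis]) (by simp [hadBasis]) (by simp [qracState]) (by simp [qracState]),
      hb (1 / Real.sqrt 2) (1 / Real.sqrt 2) (Real.cos (π / 8)) (Real.sin (π / 8))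
        (hadBasis false) (qracState false false)
        (by simp [hadBasis]) (by simp [hadBasis]) (by simp [qracState]) (by simp [qracState])]
    rw [hinv]
    generalize Real.sin (π / 8) = s at *
    generalize Real.cos (π / 8) = c at *
    generalize Real.sqrt 2 = r at *
    linear_combination (1 / 2) * hc + (1 / 8) * r ^ 2 * (hcs + hs) + (1 / 8 + r / 16) * h2
  · rw [hinv]
    nlinarith
end

section
/- For the quantum strategy with two-qubit product states ψ_{x_{1,0},x_{1,1}} ⊗ ψ_{x_{2,0},x_{2,1}} and product measurements M^0_{y₁,y₂} = |e_{y₁}⟩⟨e_{y₁}| ⊗ |e_{y₂}⟩⟨e_{y₂}| and M^1_{y₁,y₂} = |h_{y₁}⟩⟨h_{y₁}| ⊗ |h_{y₂}⟩⟨h_{y₂}|, the outcome distribution is the same for s = 0 and s = 1 and, for every x ∈ {0,1}⁴, s ∈ {0,1} and (y₁, y₂) ∈ {0,1}², equals: (1/4)(1 + 1/√2)² if y₁ = x_{1,s} and y₂ = x_{2,s}; 1/8 if exactly one of y₁ = x_{1,s}, y₂ = x_{2,s} holds; and (1/4)(1 − 1/√2)² if y₁ ≠ x_{1,s} and y₂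 ≠ x_{2,s}. -/
open Real

/-- The measurement basis at the node: computational basis for query `s = 0`,
Hadamard basis for query `s = 1`. -/
noncomputable def nodeBasis (s : Bool) : Bool → Fin 2 → ℂ :=
  if s then hadBasis else compBasis

lemma born_real (v w : Fin 2 → ℂ) (a b c d : ℝ) (h0 : v 0 = a) (h1 : v 1 = b)
    (k0 : w 0 = c) (k1 : w 1 = d) : born v w = (a * c + b * d) ^ 2 := by
  unfold born
  rw [h0, h1, k0, k1, Complex.conj_ofReal, Complex.conj_ofReal, ← Complex.ofReal_mul,
    ← Complex.ofReal_mul, ← Complex.ofReal_add, Complex.normSq_ofReal]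
  ring

lemma born_single (s y a b : Bool) :
    born (nodeBasis s y) (qracState a b) =
      if y = (if s then b else a) then (1 / 2) * (1 + 1 / Real.sqrt 2)
      else (1 / 2) * (1 - 1 / Real.sqrt 2) := by
  have hr : (1 / Real.sqrt 2) ^ 2 = 1 / 2 := by
    rw [div_pow, Real.sq_sqrt (by norm_num)]; norm_num
  have hq : Real.sqrt 2 / 2 = 1 / Real.sqrt 2 := by
    rw [div_eq_div_iff (by norm_num) (by positivity)]
    rw [Real.mul_self_sqrt (by norm_num)]; norm_num
  have h2 : 2 * (π / 8) = π / 4 := by ring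
  have hc : Real.cos (π / 8) ^ 2 = 1 / 2 + (1 / Real.sqrt 2) / 2 := by
    rw [Real.cos_sq, h2, Real.cos_pi_div_four, hq]
  have hs : Real.sin (π / 8) ^ 2 = 1 / 2 - (1 / Real.sqrt 2) / 2 := by
    rw [Real.sin_sq, hc]; ring
  have hcs : 2 * Real.sin (π / 8) * Real.cos (π / 8) = 1 / Real.sqrt 2 := by
    rw [← Real.sin_two_mul, h2, Real.sin_pi_div_four, hq]
  obtain ⟨v0, v1, hv0, hv1, hv⟩ : ∃ v0 v1 : ℝ, nodeBasis s y 0 = v0 ∧ nodeBasis s y 1 = v1 ∧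
      (v0 = (if s then 1 / Real.sqrt 2 else if y then 0 else 1) ∧
       v1 = (if s then (if y then -(1 / Real.sqrt 2) else 1 / Real.sqrt 2)
        else if y then 1 else 0)) := by
    refine ⟨_, _, ?_, ?_, rfl, rfl⟩ <;> cases s <;> cases y <;>
      simp [nodeBasis, hadBasis, compBasis]
  obtain ⟨w0, w1, hw0, hw1, hw⟩ : ∃ w0 w1 : ℝ, qracState a b 0 = w0 ∧ qracState a b 1 = w1 ∧
      (w0 = (if a then (if b then -Real.sin (π / 8) else Real.sin (π / 8)) else Real.cos (π / 8)) ∧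
       w1 = (if a then Real.cos (π / 8)
        else if b then -Real.sin (π / 8) else Real.sin (π / 8))) := by
    refine ⟨_, _, ?_, ?_, rfl, rfl⟩ <;> cases a <;> cases b <;> simp [qracState]
  rw [born_real _ _ _ _ _ _ hv0 hv1 hw0 hw1]
  generalize 1 / Real.sqrt 2 = r at *
  generalize Real.cos (π / 8) = C at *
  generalize Real.sin (π / 8) = S at *
  have e1 : (r * C + r * S) ^ 2 = 1 / 2 * (1 + r) := by
    linear_combination (C + S) ^ 2 * hr + (hc + hs + hcs) / 2
  have e2 : (r * C - r * S) ^ 2 = 1 / 2 * (1 - r) := by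
    linear_combination (C - S) ^ 2 * hr + (hc + hs - hcs) / 2
  cases s <;> cases y <;> cases a <;> cases b <;> simp at hv hw <;>
    obtain ⟨rfl, rfl⟩ := hv <;> obtain ⟨rfl, rfl⟩ := hw <;> simp only [reduceCtorEq, if_true, if_false, Bool.false_eq_true] <;>
    first
    | linear_combination hc
    | linear_combination hs
    | linear_combination e1
    | linear_combination e2

/-- For the quantum strategy with product states
`ψ_{x_{1,0},x_{1,1}} ⊗ ψ_{x_{2,0},x_{2,1}}` and product measurements
(computational basis for `s = 0`, Hadamard basis for `s = 1`), the outcome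
distribution is the same for both queries and, for every
`x = (x_{1,0}, x_{1,1}, x_{2,0}, x_{2,1})`, `s` and `(y₁,y₂)`, equals
`(1/4)(1+1/√2)²` if both `y₁ = x_{1,s}` and `y₂ = x_{2,s}`, `1/8` if exactly one
of them holds, and `(1/4)(1−1/√2)²` if neither holds. -/
theorem quantum_and_distribution (x : Bool × Bool × Bool × Bool) (s : Bool)
    (y₁ y₂ : Bool) :
    born (nodeBasis s y₁) (qracState x.1 x.2.1) *
      born (nodeBasis s y₂) (qracState x.2.2.1 x.2.2.2) =
    if y₁ = (if s then x.2.1 else x.1) then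
      (if y₂ = (if s then x.2.2.2 else x.2.2.1) then
        (1 / 4) * (1 + 1 / Real.sqrt 2) ^ 2 else (1 / 8 : ℝ))
    else
      (if y₂ = (if s then x.2.2.2 else x.2.2.1) then (1 / 8 : ℝ)
        else (1 / 4) * (1 - 1 / Real.sqrt 2) ^ 2) := by
  have hr : (1 / Real.sqrt 2) ^ 2 = 1 / 2 := by
    rw [div_pow, Real.sq_sqrt (by norm_num)]; norm_num
  rw [born_single, born_single]
  generalize 1 / Real.sqrt 2 = r at *
  split_ifs <;> first | ring1 | linear_combination (-1 / 4) * hr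
end

section
/- The quantum strategy with product states ψ_{x_{1,0},x_{1,1}} ⊗ ψ_{x_{2,0},x_{2,1}} and product measurements in the computational basis (for s = 0) and Hadamard basis (for s = 1) achieves AND-prediction witness value exactly (11 + 2√2)/40; that is, (1/80)·Σ_{s∈{0,1}} Σ_{x∈{0,1}⁴} Σ_{(y₁,y₂) : y₁·y₂ = x_{1,s}·x_{2,s}} |⟨basis_s(y₁), ψ_{x_{1,0},x_{1,1}}⟩|² · |⟨basis_s(y₂), ψ_{x_{2,0},x_{2,1}}⟩|² = (11 + 2√2)/40. -/
open Real

theorem born_val (s y a b : Bool) : born (nodeBasis s y) (qracState a b) =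
    if y = (if s then b else a) then (2 + Real.sqrt 2) / 4 else (2 - Real.sqrt 2) / 4 := by
  have h2 : Real.sqrt 2 ^ 2 = 2 := Real.sq_sqrt (by norm_num)
  have hi : (Real.sqrt 2)⁻¹ ^ 2 = 1 / 2 := by rw [inv_pow, h2]; norm_num
  have h1 := Real.sin_sq_add_cos_sq (π / 8)
  have hc : Real.cos (π / 8) ^ 2 = (2 + Real.sqrt 2) / 4 := by
    rw [Real.cos_sq, show 2 * (π / 8) = π / 4 by ring, Real.cos_pi_div_four]; ring
  have hs : Real.sin (π / 8) ^ 2 = (2 - Real.sqrt 2) / 4 := by linarith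
  have hsc : Real.sin (π / 8) * Real.cos (π / 8) = Real.sqrt 2 / 4 := by
    have := Real.sin_two_mul (π / 8)
    rw [show 2 * (π / 8) = π / 4 by ring, Real.sin_pi_div_four] at this
    linarith
  generalize hC : Real.cos (π / 8) = c at *
  generalize hS : Real.sin (π / 8) = d at *
  generalize hI : (Real.sqrt 2)⁻¹ = r at *
  cases s <;> cases y <;> cases a <;> cases b <;>
    simp [born, nodeBasis, compBasis, hadBasis, qracState, Complex.normSq_apply, hC, hS, hI,
      -Complex.ofReal_cos, -Complex.ofReal_sin, -Complex.ofReal_inv, ← Complex.ofReal_inv] <;>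
    first
    | linear_combination hc
    | linear_combination hs
    | linear_combination (c + d) ^ 2 * hi + (1 / 2) * (hc + hs + 2 * hsc)
    | linear_combination (c - d) ^ 2 * hi + (1 / 2) * (hc + hs - 2 * hsc)

/-- The quantum strategy with product states
`ψ_{x_{1,0},x_{1,1}} ⊗ ψ_{x_{2,0},x_{2,1}}` and product measurements in the
computational basis (`s = 0`) and Hadamard basis (`s = 1`) achieves the
AND-prediction witness value exactly `(11 + 2√2)/40`. -/
theorem quantum_and_witness_value :
    (1 / 80 : ℝ) *
      ∑ s : Bool, ∑ x : Bool × Bool × Bool × Bool,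
        ∑ y ∈ (Finset.univ : Finset (Bool × Bool)).filter
            (fun y => (y.1 && y.2) =
              ((if s then x.2.1 else x.1) && (if s then x.2.2.2 else x.2.2.1))),
          born (nodeBasis s y.1) (qracState x.1 x.2.1) *
            born (nodeBasis s y.2) (qracState x.2.2.1 x.2.2.2)
      = (11 + 2 * Real.sqrt 2) / 40 := by
  have h2 : Real.sqrt 2 ^ 2 = 2 := Real.sq_sqrt (by norm_num)
  simp only [born_val, Finset.sum_filter, Fintype.sum_prod_type, Fintype.sum_bool]
  simp
  ring_nf
  rw [h2]
  ring
end
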